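/- Let (Ω, F, P) be a nonatomic probability space, let Φ be an Orlicz function that is finite-valued, continuous and strictly increasing, and let H_Φ be the associated Orlicz premium on L∞₊. If H_Φ is cash-additive (H_Φ(X + h) = H_Φ(X) + h for every X ∈ L∞₊ and constant h ≥ 0) and GG-convex (H_Φ(X^λ Y^{1−λ}) ≤ H_Φ(X)^λ H_Φ(Y)^{1−λ} for all X, Y ∈ L∞₊, λ ∈ (0,1)), then there exist constants a ≥ b > 0 such that Φ(x) = 1 + a·(x−1)₊ − b·(x−1)₋ for all x ≥ 0. -/

import Mathlib

open MeasureTheory Filter Set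
open scoped ENNReal

noncomputable section

variable {Ω : Type*} [MeasurableSpace Ω]

/-- `X` belongs to `L^∞_+(P)`: it is measurable, `P`-a.s. nonnegative and
`P`-essentially bounded. -/
def MemLinftyPlus (P : Measure Ω) (X : Ω → ℝ) : Prop :=
  Measurable X ∧ (∀ᵐ ω ∂P, 0 ≤ X ω) ∧ ∃ C : ℝ, ∀ᵐ ω ∂P, X ω ≤ C

/-- `X` belongs to `L^∞_++(P)`: it is measurable, bounded away from `0` and
`P`-essentially bounded. -/
def MemLinftyPlusPlus (P : Measure Ω) (X : Ω → ℝ) : Prop :=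
  Measurable X ∧ (∃ c : ℝ, 0 < c ∧ ∀ᵐ ω ∂P, c ≤ X ω) ∧ ∃ C : ℝ, ∀ᵐ ω ∂P, X ω ≤ C

/-- An Orlicz function `Φ : [0,∞) → ℝ ∪ {±∞}`: nondecreasing, left-continuous,
`Φ(x) > -∞` for `x > 0`, `Φ(x) ≤ 1` for `0 ≤ x ≤ 1` and `Φ(x) > 1` for `x > 1`. -/
structure IsOrliczFunction (Φ : ℝ → EReal) : Prop where
  ne_bot : ∀ x : ℝ, 0 < x → Φ x ≠ ⊥
  le_one : ∀ x : ℝ, 0 ≤ x → x ≤ 1 → Φ x ≤ 1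
  one_lt : ∀ x : ℝ, 1 < x → 1 < Φ x
  mono : ∀ x y : ℝ, 0 ≤ x → x ≤ y → Φ x ≤ Φ y
  left_cont : ∀ x : ℝ, 0 < x → Φ x = ⨆ y : Set.Ico (0 : ℝ) x, Φ (y : ℝ)

/-- The nonnegative part of an extended real, as an extended nonnegative real. -/
def erealToENNReal (x : EReal) : ℝ≥0∞ :=
  if x = ⊤ then ⊤ else ENNReal.ofReal x.toReal

/-- Expectation of an extended-real-valued function: positive part minus negative part. -/
def eexp (P : Measure Ω) (f : Ω → EReal) : EReal :=
  ((∫⁻ ω, erealToENNReal (f ω) ∂P : ℝ≥0∞) : EReal)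
    - ((∫⁻ ω, erealToENNReal (-(f ω)) ∂P : ℝ≥0∞) : EReal)

/-- The (generalized) Orlicz premium `H_Φ(X) = inf {k > 0 | E[Φ(X/k)] ≤ 1}`, with the
convention `H_Φ(X) = 0` if `Φ(0) = -∞` and `P(X = 0) > 0`. -/
def orliczPremium (P : Measure Ω) (Φ : ℝ → EReal) (X : Ω → ℝ) : ℝ :=
  if Φ 0 = ⊥ ∧ 0 < P {ω | X ω = 0} then 0
  else sInf {k : ℝ | 0 < k ∧ eexp P (fun ω => Φ (X ω / k)) ≤ 1}

/-- Addition on `EReal` with the convention `(-∞) + (+∞) = +∞`. -/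
def eadd (a b : EReal) : EReal :=
  if (a = ⊥ ∧ b = ⊤) ∨ (a = ⊤ ∧ b = ⊥) then ⊤ else a + b

/-- Multiplication on `ℝ≥0∞` with the convention `0 * ∞ = ∞`. -/
def gmulE (a b : ℝ≥0∞) : ℝ≥0∞ :=
  if (a = 0 ∧ b = ⊤) ∨ (a = ⊤ ∧ b = 0) then ⊤ else a * b

/-- power law from the translated equation. -/
lemma aux_power (f : ℝ → ℝ) (hmono : StrictMonoOn f (Set.Ici 0))
    (hc : ContinuousOn f (Set.Ici 0)) (h1 : f 1 = 1)
    (hCA : ∀ p u v h : ℝ, 0 ≤ p → p ≤ 1 → 1 ≤ u → 0 ≤ v → v ≤ 1 → 0 < h →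
      p * f u + (1 - p) * f v = 1 →
      p * f ((u + h) / (1 + h)) + (1 - p) * f ((v + h) / (1 + h)) = 1) :
    ∃ A B c : ℝ, 0 < A ∧ 0 < B ∧ 0 < c ∧ (∀ a : ℝ, 0 < a → f (1 + a) = 1 + A * a ^ c) ∧
      (∀ b : ℝ, 0 < b → b ≤ 1 → f (1 - b) = 1 - B * b ^ c) := by
  have hpos : ∀ a : ℝ, 0 < a → 0 < f (1 + a) - 1 := by
    intro a ha
    have := hmono (show (1:ℝ) ∈ Set.Ici 0 by simp) (show (1 + a) ∈ Set.Ici 0 by simp; linarith)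
      (by linarith)
    linarith
  have hneg : ∀ b : ℝ, 0 < b → b ≤ 1 → 0 < 1 - f (1 - b) := by
    intro b hb hb1
    have := hmono (show (1 - b) ∈ Set.Ici 0 by simp; linarith) (show (1:ℝ) ∈ Set.Ici 0 by simp)
      (by linarith)
    linarith
  have key : ∀ t a b : ℝ, 0 < t → t < 1 → 0 < a → 0 < b → b ≤ 1 →
      (f (1 + t * a) - 1) * (1 - f (1 - b)) = (f (1 + a) - 1) * (1 - f (1 - t * b)) := by
    intro t a b ht ht1 ha hb hb1
    have ga := hpos a ha
    have gb := hneg b hb hb1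
    have hs : 0 < (f (1 + a) - 1) + (1 - f (1 - b)) := by linarith
    have := hCA ((1 - f (1 - b)) / ((f (1 + a) - 1) + (1 - f (1 - b)))) (1 + a) (1 - b)
      (1 / t - 1) (by positivity) (by rw [div_le_one hs]; linarith) (by linarith) (by linarith)
      (by linarith) (by rw [sub_pos, lt_div_iff₀ ht]; linarith) (by field_simp; ring)
    have e1 : (1 + a + (1 / t - 1)) / (1 + (1 / t - 1)) = 1 + t * a := by field_simp; ring
    have e2 : (1 - b + (1 / t - 1)) / (1 + (1 / t - 1)) = 1 - t * b := by field_simp; ring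
    rw [e1, e2] at this
    rw [mul_comm t a, mul_comm t b] at *
    field_simp at this
    linear_combination this
  set A := f (1 + 1) - 1 with hA
  set B := 1 - f (1 - 1) with hB
  have hA0 : 0 < A := hpos 1 one_pos
  have hB0 : 0 < B := hneg 1 one_pos le_rfl
  set G : ℝ → ℝ := fun a => (f (1 + a) - 1) / A with hG
  have hGpos : ∀ a, 0 < a → 0 < G a := fun a ha => div_pos (hpos a ha) hA0
  have hG1 : G 1 = 1 := by simp only [hG]; rw [← hA]; exact div_self hA0.ne'
  have k1 : ∀ t, 0 < t → t < 1 → 1 - f (1 - t) = B * G t := by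
    intro t ht ht1
    have := key t 1 1 ht ht1 one_pos one_pos le_rfl
    simp only [mul_one] at this
    rw [← hA, ← hB] at this
    simp only [hG]
    field_simp
    linarith
  have k2 : ∀ t a, 0 < t → t ≤ 1 → 0 < a → G (t * a) = G t * G a := by
    intro t a ht ht1 ha
    rcases ht1.lt_or_eq with h | rfl
    · have := key t a 1 ht h ha one_pos le_rfl
      rw [← hB, mul_one, k1 t ht h] at this
      simp only [hG] at this ⊢
      field_simp at this ⊢
      linarith
    · rw [one_mul, hG1, one_mul]
  have k3 : ∀ a b, 0 < a → 0 < b → G (a * b) = G a * G b := by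
    intro a b ha hb
    rcases le_total a 1 with h | h
    · exact k2 a b ha h hb
    · have e1 := k2 a⁻¹ (a * b) (by positivity) (inv_le_one_of_one_le₀ h) (by positivity)
      have e2 := k2 a⁻¹ a (by positivity) (inv_le_one_of_one_le₀ h) (by positivity)
      rw [inv_mul_cancel_left₀ ha.ne'] at e1
      rw [inv_mul_cancel₀ ha.ne', hG1] at e2
      rw [e1]; linear_combination G (a * b) * e2
  have hGc : Continuous (fun s : ℝ => Real.log (G (Real.exp s))) := by
    have : Continuous (fun s : ℝ => G (Real.exp s)) := by
      refine Continuous.div_const (Continuous.sub ?_ continuous_const) _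
      refine hc.comp_continuous (by fun_prop) ?_
      intro x; simp; positivity
    exact this.log (fun s => (hGpos _ (Real.exp_pos s)).ne')
  let L : ℝ →+ ℝ := AddMonoidHom.mk' (fun s : ℝ => Real.log (G (Real.exp s))) (by
    intro a b
    rw [Real.exp_add, k3 _ _ (Real.exp_pos _) (Real.exp_pos _),
      Real.log_mul (hGpos _ (Real.exp_pos _)).ne' (hGpos _ (Real.exp_pos _)).ne'])
  have hL : ∀ s : ℝ, L s = s * L 1 := by
    intro s
    have := map_real_smul L hGc s 1
    simpa using this
  have hGe : ∀ x, 0 < x → G x = x ^ (L 1) := by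
    intro x hx
    have := hL (Real.log x)
    rw [Real.rpow_def_of_pos hx, ← this]
    change _ = Real.exp (Real.log (G (Real.exp (Real.log x))))
    rw [Real.exp_log hx, Real.exp_log (hGpos x hx)]
  refine ⟨A, B, L 1, hA0, hB0, ?_, ?_, ?_⟩
  · change 0 < Real.log (G (Real.exp 1))
    apply Real.log_pos
    simp only [hG]
    rw [lt_div_iff₀ hA0, one_mul, hA]
    have := hmono (show (1 + 1:ℝ) ∈ Set.Ici 0 by rw [Set.mem_Ici]; norm_num)
      (show (1 + Real.exp 1) ∈ Set.Ici 0 by simp; positivity)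
      (by have := Real.add_one_lt_exp (one_ne_zero); linarith)
    linarith
  · intro a ha
    rw [← hGe a ha]; simp only [hG]; field_simp; ring
  · intro b hb hb1
    rw [← hGe b hb]
    rcases hb1.lt_or_eq with h | rfl
    · linarith [k1 b hb h]
    · rw [hG1, hB]; ring

/-- the exponent is one. -/
lemma aux_exponent (f : ℝ → ℝ) (A B c p q r : ℝ) (hA : 0 < A) (hB : 0 < B) (hc : 0 < c)
    (h1 : f 1 = 1)
    (hfp : ∀ a : ℝ, 0 < a → f (1 + a) = 1 + A * a ^ c)
    (hfm : ∀ b : ℝ, 0 < b → b ≤ 1 → f (1 - b) = 1 - B * b ^ c)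
    (hp : 0 < p) (hq : 0 < q) (hr : 0 < r) (hpqr : p + q + r = 1)
    (hGG : ∀ x y z x' y' z' : ℝ, 0 < x → 0 < y → 0 < z → 0 < x' → 0 < y' → 0 < z' →
      p * f x + q * f y + r * f z = 1 → p * f x' + q * f y' + r * f z' = 1 →
      p * f (√(x * x')) + q * f (√(y * y')) + r * f (√(z * z')) ≤ 1) : c = 1 := by
  have hc0 : c ≠ 0 := hc.ne'
  obtain ⟨α, hα, hαp⟩ : ∃ α : ℝ, 0 < α ∧ p * α ^ c = 1 :=
    ⟨(p⁻¹) ^ c⁻¹, by positivity, by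
      rw [Real.rpow_inv_rpow (by positivity) hc0]; exact mul_inv_cancel₀ hp.ne'⟩
  obtain ⟨β, hβ, hβq⟩ : ∃ β : ℝ, 0 < β ∧ q * β ^ c = 1 :=
    ⟨(q⁻¹) ^ c⁻¹, by positivity, by
      rw [Real.rpow_inv_rpow (by positivity) hc0]; exact mul_inv_cancel₀ hq.ne'⟩
  obtain ⟨γ, hγ, hγr⟩ : ∃ γ : ℝ, 0 < γ ∧ A * (r * γ ^ c) = B :=
    ⟨(B / (A * r)) ^ c⁻¹, by positivity, by
      rw [Real.rpow_inv_rpow (by positivity) hc0]; field_simp⟩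
  obtain ⟨δ, hδ, hδr⟩ : ∃ δ : ℝ, 0 < δ ∧ B * (r * δ ^ c) = A :=
    ⟨(A / (B * r)) ^ c⁻¹, by positivity, by
      rw [Real.rpow_inv_rpow (by positivity) hc0]; field_simp⟩
  have hlin : ∀ k : ℝ, ∀ᶠ e : ℝ in nhdsWithin 0 (Set.Ioi 0), e * k < 1 := by
    intro k
    have : Tendsto (fun e : ℝ => e * k) (nhdsWithin 0 (Set.Ioi 0)) (nhds (0 * k)) :=
      ((continuous_id.mul continuous_const).tendsto 0).mono_left nhdsWithin_le_nhds
    exact this.eventually (gt_mem_nhds (by simp))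
  have hepos : ∀ᶠ e : ℝ in nhdsWithin 0 (Set.Ioi 0), 0 < e := self_mem_nhdsWithin
  have hlim : ∀ k : ℝ, Tendsto (fun e : ℝ => (1 + √(1 + e * k)) ^ (-c))
      (nhdsWithin 0 (Set.Ioi 0)) (nhds ((2:ℝ) ^ (-c))) := by
    intro k
    have h2 : Tendsto (fun e : ℝ => (1 + √(1 + e * k)) ^ (-c)) (nhds 0)
        (nhds ((1 + √(1 + 0 * k)) ^ (-c))) := by
      apply Continuous.tendsto
      refine Continuous.rpow_const (by fun_prop) ?_
      intro x; left; positivity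
    have e2 : (1 + √(1 + 0 * k)) = (2:ℝ) := by norm_num
    rw [e2] at h2
    exact h2.mono_left nhdsWithin_le_nhds
  have hle : (2:ℝ) ^ (-c) + 2 ^ (-c) ≤ 1 := by
    refine le_of_tendsto ((hlim α).add (hlim β)) ?_
    filter_upwards [hepos, hlin δ] with e he hed
    have hsq : ∀ k, 0 < k → f √(1 + e * k) = 1 + A * (e ^ c * k ^ c * (1 + √(1 + e * k)) ^ (-c)) := by
      intro k hk
      have hs : 0 ≤ 1 + e * k := by positivity
      have : √(1 + e * k) = 1 + e * k / (1 + √(1 + e * k)) := by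
        have := Real.mul_self_sqrt hs
        field_simp
        linarith
      have h3 : f √(1 + e * k) = f (1 + e * k / (1 + √(1 + e * k))) := by rw [← this]
      rw [h3, hfp _ (by positivity), Real.div_rpow (by positivity) (by positivity),
        Real.mul_rpow he.le hk.le, Real.rpow_neg (by positivity)]
      rfl
    have hec : 0 < e ^ c := by positivity
    have h := hGG (1 + e * α) 1 (1 - e * δ) 1 (1 + e * β) (1 - e * δ) (by positivity) one_pos
      (by linarith) one_pos (by positivity) (by linarith)
      (by rw [hfp _ (by positivity), h1, hfm _ (by positivity) hed.le,
            Real.mul_rpow he.le hα.le, Real.mul_rpow he.le hδ.le]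
          linear_combination hpqr + A * e ^ c * hαp - e ^ c * hδr)
      (by rw [hfp _ (by positivity), h1, hfm _ (by positivity) hed.le,
            Real.mul_rpow he.le hβ.le, Real.mul_rpow he.le hδ.le]
          linear_combination hpqr + A * e ^ c * hβq - e ^ c * hδr)
    rw [mul_one, one_mul, hsq α hα, hsq β hβ, Real.sqrt_mul_self (by linarith),
      hfm _ (by positivity) hed.le, Real.mul_rpow he.le hδ.le] at h
    set U := (1 + √(1 + e * α)) ^ (-c)
    set V := (1 + √(1 + e * β)) ^ (-c)
    have h5 : (A * e ^ c) * (U + V) ≤ (A * e ^ c) * 1 := by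
      linear_combination h - hpqr - A * e ^ c * U * hαp - A * e ^ c * V * hβq + e ^ c * hδr
    exact le_of_mul_le_mul_left h5 (by positivity)
  have hge : 1 ≤ (2:ℝ) ^ (-c) + 2 ^ (-c) := by
    refine ge_of_tendsto ((hlim (-α)).add (hlim (-β))) ?_
    filter_upwards [hepos, hlin α, hlin β] with e he hea heb
    have hsq : ∀ k, 0 < k → e * k < 1 →
        f √(1 - e * k) = 1 - B * (e ^ c * k ^ c * (1 + √(1 + e * -k)) ^ (-c)) := by
      intro k hk hek
      have hs : 0 ≤ 1 - e * k := by linarith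
      have hss := Real.sqrt_nonneg (1 - e * k)
      have : √(1 - e * k) = 1 - e * k / (1 + √(1 - e * k)) := by
        have := Real.mul_self_sqrt hs
        field_simp
        linarith
      have h3 : f √(1 - e * k) = f (1 - e * k / (1 + √(1 - e * k))) := by rw [← this]
      have h4 : 1 + e * -k = 1 - e * k := by ring
      rw [h4, h3, hfm _ (by positivity) (by rw [div_le_one (by positivity)]; linarith),
        Real.div_rpow (by positivity) (by positivity),
        Real.mul_rpow he.le hk.le, Real.rpow_neg (by positivity)]
      rfl
    have hec : 0 < e ^ c := by positivity
    have h := hGG (1 - e * α) 1 (1 + e * γ) 1 (1 - e * β) (1 + e * γ) (by linarith) one_pos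
      (by positivity) one_pos (by linarith) (by positivity)
      (by rw [hfm _ (by positivity) hea.le, h1, hfp _ (by positivity),
            Real.mul_rpow he.le hα.le, Real.mul_rpow he.le hγ.le]
          linear_combination hpqr - B * e ^ c * hαp + e ^ c * hγr)
      (by rw [hfm _ (by positivity) heb.le, h1, hfp _ (by positivity),
            Real.mul_rpow he.le hβ.le, Real.mul_rpow he.le hγ.le]
          linear_combination hpqr - B * e ^ c * hβq + e ^ c * hγr)
    rw [mul_one, one_mul, hsq α hα hea, hsq β hβ heb, Real.sqrt_mul_self (by positivity),
      hfp _ (by positivity), Real.mul_rpow he.le hγ.le] at h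
    set U := (1 + √(1 + e * -α)) ^ (-c)
    set V := (1 + √(1 + e * -β)) ^ (-c)
    have h5 : (B * e ^ c) * 1 ≤ (B * e ^ c) * (U + V) := by
      linear_combination h - hpqr + B * e ^ c * U * hαp + B * e ^ c * V * hβq - e ^ c * hγr
    exact le_of_mul_le_mul_left h5 (by positivity)
  have heq : (2:ℝ) ^ (-c) = 2 ^ (-1 : ℝ) := by
    rw [Real.rpow_neg_one]; linarith
  have := Real.rpow_right_inj (x := 2) (by norm_num) (by norm_num) |>.1 heq
  linarith

/-- the slopes are ordered. -/
lemma aux_slopes (f : ℝ → ℝ) (A B : ℝ) (hA : 0 < A) (hB : 0 < B)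
    (hmono : StrictMonoOn f (Set.Ici 0)) (h1 : f 1 = 1)
    (hfp : ∀ a : ℝ, 0 < a → f (1 + a) = 1 + A * a)
    (hfm : ∀ b : ℝ, 0 < b → b ≤ 1 → f (1 - b) = 1 - B * b)
    (hGG : ∀ x z x' z' : ℝ, 0 < x → 0 < z → 0 < x' → 0 < z' →
      1 / 2 * f x + 1 / 2 * f z = 1 → 1 / 2 * f x' + 1 / 2 * f z' = 1 →
      1 / 2 * f (√(x * x')) + 1 / 2 * f (√(z * z')) ≤ 1) : B ≤ A := by
  by_contra! hlt
  set e := (B - A) / (2 * (A * B + B ^ 2)) with he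
  have he0 : 0 < e := div_pos (by linarith) (by positivity)
  have heA : e * (A * B) < B - A := by
    rw [he, div_mul_eq_mul_div, div_lt_iff₀ (by positivity)]
    have : 0 < B - A := by linarith
    nlinarith [mul_pos hA hB, mul_pos hB hB, mul_pos this (mul_pos hA hB), mul_pos this (mul_pos hB hB)]
  have heA1 : e * A < 1 := by
    have : e * A * B < 1 * B := by nlinarith
    exact lt_of_mul_lt_mul_right this hB.le
  have h := hGG (1 + e * B) (1 - e * A) (1 - e * A) (1 + e * B) (by positivity) (by linarith)
    (by linarith) (by positivity)
    (by rw [hfp _ (by positivity), hfm _ (by positivity) heA1.le]; ring)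
    (by rw [hfp _ (by positivity), hfm _ (by positivity) heA1.le]; ring)
  rw [mul_comm (1 - e * A)] at h
  have hs : 1 < √((1 + e * B) * (1 - e * A)) := by
    rw [Real.lt_sqrt (by norm_num)]
    nlinarith
  have := hmono (show (1:ℝ) ∈ Set.Ici 0 by simp) (show _ ∈ Set.Ici 0 from Real.sqrt_nonneg _) hs
  linarith

open Classical in
/-- three-valued random variable. -/
def triRV (S T : Set Ω) (x y z : ℝ) : Ω → ℝ :=
  fun ω => if ω ∈ S then x else if ω ∈ T then y else z

lemma triRV_mem (P : Measure Ω) {S T : Set Ω} (hS : MeasurableSet S) (hT : MeasurableSet T)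
    {x y z : ℝ} (hx : 0 ≤ x) (hy : 0 ≤ y) (hz : 0 ≤ z) : MemLinftyPlus P (triRV S T x y z) := by
  refine ⟨?_, ?_, x + y + z, ?_⟩
  · unfold triRV
    exact Measurable.ite hS measurable_const (Measurable.ite hT measurable_const measurable_const)
  · refine Eventually.of_forall fun ω => ?_
    unfold triRV; split_ifs <;> assumption
  · refine Eventually.of_forall fun ω => ?_
    unfold triRV; split_ifs <;> linarith

lemma triRV_lintegral (P : Measure Ω) {S T : Set Ω} (hS : MeasurableSet S) (hT : MeasurableSet T)
    (hST : Disjoint S T) (x y z : ℝ) (F : ℝ → ℝ≥0∞) :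
    ∫⁻ ω, F (triRV S T x y z ω) ∂P = F x * P S + F y * P T + F z * P (S ∪ T)ᶜ := by
  have : (fun ω => F (triRV S T x y z ω)) = fun ω =>
      (S.indicator (fun _ => F x) ω + T.indicator (fun _ => F y) ω)
        + (S ∪ T)ᶜ.indicator (fun _ => F z) ω := by
    funext ω
    unfold triRV
    by_cases h1 : ω ∈ S
    · have h2 : ω ∉ T := fun h => Set.disjoint_left.1 hST h1 h
      simp [h1, h2]
    · by_cases h2 : ω ∈ T <;> simp [h1, h2]
  rw [this, lintegral_add_left, lintegral_add_left, lintegral_indicator_const hS,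
    lintegral_indicator_const hT, lintegral_indicator_const (hS.union hT).compl]
  · exact measurable_const.indicator hS
  · exact (measurable_const.indicator hS).add (measurable_const.indicator hT)

lemma erealToENNReal_coe (a : ℝ) : erealToENNReal (a : EReal) = ENNReal.ofReal a := by
  simp [erealToENNReal]

/-- A measurable pair of disjoint events with probabilities `p` and `q`. -/
structure TriPart (P : Measure Ω) (S T : Set Ω) (p q r : ℝ) : Prop where
  hS : MeasurableSet S
  hT : MeasurableSet T
  hST : Disjoint S T
  hp : 0 ≤ p
  hq : 0 ≤ q
  hr : 0 ≤ r
  hsum : p + q + r = 1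
  hPS : P S = ENNReal.ofReal p
  hPT : P T = ENNReal.ofReal q
  hPR : P (S ∪ T)ᶜ = ENNReal.ofReal r

lemma triRV_eexp {P : Measure Ω} {S T : Set Ω} {p q r : ℝ} (h : TriPart P S T p q r)
    (x y z k : ℝ) (Φ : ℝ → EReal) (a b c : ℝ) (hx : Φ (x / k) = a) (hy : Φ (y / k) = b)
    (hz : Φ (z / k) = c) :
    eexp P (fun ω => Φ (triRV S T x y z ω / k)) = ((p * a + q * b + r * c : ℝ) : EReal) := by
  unfold eexp
  rw [triRV_lintegral P h.hS h.hT h.hST x y z (fun t => erealToENNReal (Φ (t / k))),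
    triRV_lintegral P h.hS h.hT h.hST x y z (fun t => erealToENNReal (-Φ (t / k)))]
  simp only [hx, hy, hz, ← EReal.coe_neg, erealToENNReal_coe, h.hPS, h.hPT, h.hPR]
  have aux : ∀ a b c : ℝ, ENNReal.ofReal a * ENNReal.ofReal p + ENNReal.ofReal b * ENNReal.ofReal q
      + ENNReal.ofReal c * ENNReal.ofReal r
      = ENNReal.ofReal (max a 0 * p + max b 0 * q + max c 0 * r) := by
    intro a b c
    have hp := h.hp
    have hq := h.hq
    have hr := h.hr
    rw [ENNReal.ofReal_add (by positivity) (by positivity),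
      ENNReal.ofReal_add (by positivity) (by positivity),
      ENNReal.ofReal_mul (by positivity), ENNReal.ofReal_mul (by positivity),
      ENNReal.ofReal_mul (by positivity)]
    simp [ENNReal.ofReal_max]
  have hp := h.hp
  have hq := h.hq
  have hr := h.hr
  rw [aux, aux, EReal.coe_ennreal_ofReal, EReal.coe_ennreal_ofReal,
    max_eq_left (a := max a 0 * p + max b 0 * q + max c 0 * r) (by positivity),
    max_eq_left (a := max (-a) 0 * p + max (-b) 0 * q + max (-c) 0 * r) (by positivity),
    ← EReal.coe_sub]
  congr 1
  have e : ∀ a : ℝ, max a 0 - max (-a) 0 = a := by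
    intro a; rcases le_total a 0 with h | h <;> simp [h]
  linear_combination p * e a + q * e b + r * e c

section
variable {P : Measure Ω} {S T : Set Ω} {p q r : ℝ} {Φ : ℝ → EReal} {f : ℝ → ℝ}

lemma tri_premium_eq (h : TriPart P S T p q r)
    (hf : ∀ x, 0 ≤ x → Φ x = f x) (hmono : StrictMonoOn f (Set.Ici 0)) (h1 : f 1 = 1)
    {x y z k : ℝ} (hx : 0 ≤ x) (hy : 0 ≤ y) (hz : 0 ≤ z) (hk : 0 < k)
    (heq : p * f (x / k) + q * f (y / k) + r * f (z / k) = 1) :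
    orliczPremium P Φ (triRV S T x y z) = k := by
  have hp := h.hp
  have hq := h.hq
  have hr := h.hr
  have hE : ∀ j, 0 < j → eexp P (fun ω => Φ (triRV S T x y z ω / j))
      = ((p * f (x / j) + q * f (y / j) + r * f (z / j) : ℝ) : EReal) := fun j hj =>
    triRV_eexp h x y z j Φ _ _ _ (hf _ (by positivity)) (hf _ (by positivity))
      (hf _ (by positivity))
  unfold orliczPremium
  rw [if_neg (by rw [hf 0 le_rfl]; simp)]
  have : {k : ℝ | 0 < k ∧ eexp P (fun ω => Φ (triRV S T x y z ω / k)) ≤ 1} = Set.Ici k := by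
    ext j
    simp only [Set.mem_ofPred_eq, Set.mem_Ici]
    have hm : ∀ x i j : ℝ, 0 ≤ x → 0 < i → i ≤ j → f (x / j) ≤ f (x / i) := by
      intro x i j hx hi hij
      have hj : 0 < j := hi.trans_le hij
      exact hmono.monotoneOn (show x / j ∈ Set.Ici 0 from by rw [Set.mem_Ici]; positivity)
        (show x / i ∈ Set.Ici 0 from by rw [Set.mem_Ici]; positivity)
        (div_le_div_of_nonneg_left hx hi hij)
    constructor
    · rintro ⟨hj, hle⟩
      rw [hE j hj] at hle
      have hle' : p * f (x / j) + q * f (y / j) + r * f (z / j) ≤ 1 := by exact_mod_cast hle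
      by_contra! hlt
      have hst : ∀ x w : ℝ, 0 ≤ x → 0 ≤ w → w * f (x / k) ≤ w * f (x / j) ∧
          (w * f (x / k) = w * f (x / j) → w * f (x / k) = w * f 0) := by
        intro x w hx hw
        refine ⟨mul_le_mul_of_nonneg_left (hm x j k hx hj hlt.le) hw, fun he => ?_⟩
        rcases hw.eq_or_lt with rfl | hw
        · simp
        · rcases hx.eq_or_lt with rfl | hx
          · simp
          · exfalso
            have := hmono (show x / k ∈ Set.Ici 0 from by rw [Set.mem_Ici]; positivity)
              (show x / j ∈ Set.Ici 0 from by rw [Set.mem_Ici]; positivity)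
              (div_lt_div_of_pos_left hx hj hlt)
            exact this.ne (mul_left_cancel₀ hw.ne' he)
      obtain ⟨a1, a2⟩ := hst x p hx hp
      obtain ⟨b1, b2⟩ := hst y q hy hq
      obtain ⟨c1, c2⟩ := hst z r hz hr
      have a3 := a2 (by linarith)
      have b3 := b2 (by linarith)
      have c3 := c2 (by linarith)
      have h0 := hmono (show (0:ℝ) ∈ Set.Ici 0 by simp) (show (1:ℝ) ∈ Set.Ici 0 by simp) one_pos
      have : (p + q + r) * f 0 = 1 := by linarith
      rw [h.hsum] at this
      linarith
    · intro hkj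
      have hj : 0 < j := hk.trans_le hkj
      refine ⟨hj, ?_⟩
      rw [hE j hj]
      have h2 : p * f (x / j) + q * f (y / j) + r * f (z / j) ≤ 1 := by
        rw [← heq]
        have := hm x k j hx hk hkj
        have := hm y k j hy hk hkj
        have := hm z k j hz hk hkj
        gcongr
      exact_mod_cast h2
  rw [this, csInf_Ici]

lemma tri_premium_exists (h : TriPart P S T p q r)
    (hf : ∀ x, 0 ≤ x → Φ x = f x) (hmono : StrictMonoOn f (Set.Ici 0))
    (hc : ContinuousOn f (Set.Ici 0)) (h1 : f 1 = 1)
    {x y z : ℝ} (hx : 0 < x) (hy : 0 < y) (hz : 0 < z) :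
    ∃ k, 0 < k ∧ orliczPremium P Φ (triRV S T x y z) = k ∧
      p * f (x / k) + q * f (y / k) + r * f (z / k) = 1 := by
  have hp := h.hp
  have hq := h.hq
  have hr := h.hr
  set m := min x (min y z) with hm
  set M := max x (max y z) with hM
  have hm0 : 0 < m := lt_min hx (lt_min hy hz)
  have hmx : m ≤ x := min_le_left _ _
  have hmy : m ≤ y := (min_le_right _ _).trans (min_le_left _ _)
  have hmz : m ≤ z := (min_le_right _ _).trans (min_le_right _ _)
  have hMx : x ≤ M := le_max_left _ _
  have hMy : y ≤ M := (le_max_left _ _).trans (le_max_right _ _)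
  have hMz : z ≤ M := (le_max_right _ _).trans (le_max_right _ _)
  have hM0 : 0 < M := hx.trans_le hMx
  have hcont : ∀ x, 0 < x → ContinuousOn (fun k : ℝ => f (x / k)) (Set.Icc m M) := by
    intro x hx
    refine hc.comp (ContinuousOn.div continuousOn_const continuousOn_id ?_) ?_
    · intro k hk; exact (hm0.trans_le hk.1).ne'
    · intro k hk
      have : 0 < k := hm0.trans_le hk.1
      rw [Set.mem_Ici]; positivity
  have hup : ∀ x, 0 < x → m ≤ x → 1 ≤ f (x / m) := by
    intro x hx hmx
    rw [← h1]
    exact hmono.monotoneOn (show (1:ℝ) ∈ Set.Ici 0 by simp)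
      (show x / m ∈ Set.Ici 0 from by rw [Set.mem_Ici]; positivity) ((one_le_div hm0).2 hmx)
  have hdn : ∀ x, 0 < x → x ≤ M → f (x / M) ≤ 1 := by
    intro x hx hMx
    rw [← h1]
    exact hmono.monotoneOn (show x / M ∈ Set.Ici 0 from by rw [Set.mem_Ici]; positivity)
      (show (1:ℝ) ∈ Set.Ici 0 by simp) ((div_le_one hM0).2 hMx)
  have hC : ContinuousOn (fun k : ℝ => p * f (x / k) + q * f (y / k) + r * f (z / k))
      (Set.Icc m M) :=
    ((continuousOn_const.mul (hcont x hx)).add (continuousOn_const.mul (hcont y hy))).add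
      (continuousOn_const.mul (hcont z hz))
  have hsum := h.hsum
  have hmem : (1:ℝ) ∈ Set.Icc (p * f (x / M) + q * f (y / M) + r * f (z / M))
      (p * f (x / m) + q * f (y / m) + r * f (z / m)) := by
    constructor
    · have a1 := mul_le_mul_of_nonneg_left (hdn x hx hMx) hp
      have a2 := mul_le_mul_of_nonneg_left (hdn y hy hMy) hq
      have a3 := mul_le_mul_of_nonneg_left (hdn z hz hMz) hr
      linarith
    · have a1 := mul_le_mul_of_nonneg_left (hup x hx hmx) hp
      have a2 := mul_le_mul_of_nonneg_left (hup y hy hmy) hq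
      have a3 := mul_le_mul_of_nonneg_left (hup z hz hmz) hr
      linarith
  obtain ⟨k, hk, hk1⟩ := intermediate_value_Icc' (hmx.trans hMx) hC hmem
  have hk0 : 0 < k := hm0.trans_le hk.1
  exact ⟨k, hk0, tri_premium_eq h hf hmono h1 hx.le hy.le hz.le hk0 hk1, hk1⟩

lemma tri_GG (h : TriPart P S T p q r)
    (hf : ∀ x, 0 ≤ x → Φ x = f x) (hmono : StrictMonoOn f (Set.Ici 0))
    (hc : ContinuousOn f (Set.Ici 0)) (h1 : f 1 = 1)
    (hGG : ∀ X Y : Ω → ℝ, MemLinftyPlus P X → MemLinftyPlus P Y →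
      ∀ l ∈ Set.Ioo (0 : ℝ) 1,
        orliczPremium P Φ (fun ω => X ω ^ l * Y ω ^ (1 - l)) ≤
          orliczPremium P Φ X ^ l * orliczPremium P Φ Y ^ (1 - l))
    (x y z x' y' z' : ℝ) (hx : 0 < x) (hy : 0 < y) (hz : 0 < z) (hx' : 0 < x') (hy' : 0 < y')
    (hz' : 0 < z') (e : p * f x + q * f y + r * f z = 1)
    (e' : p * f x' + q * f y' + r * f z' = 1) :
    p * f (√(x * x')) + q * f (√(y * y')) + r * f (√(z * z')) ≤ 1 := by
  have hp := h.hp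
  have hq := h.hq
  have hr := h.hr
  have H := hGG _ _ (triRV_mem P h.hS h.hT hx.le hy.le hz.le)
    (triRV_mem P h.hS h.hT hx'.le hy'.le hz'.le) (1 / 2) ⟨by norm_num, by norm_num⟩
  rw [tri_premium_eq h hf hmono h1 hx.le hy.le hz.le one_pos (by simpa using e),
    tri_premium_eq h hf hmono h1 hx'.le hy'.le hz'.le one_pos (by simpa using e')] at H
  have hs : ∀ u v : ℝ, 0 < u → 0 < v → u ^ (1 / 2 : ℝ) * v ^ (1 - 1 / 2 : ℝ) = √(u * v) := by
    intro u v hu hv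
    rw [show (1 - 1 / 2 : ℝ) = 1 / 2 by norm_num, ← Real.sqrt_eq_rpow, ← Real.sqrt_eq_rpow,
      Real.sqrt_mul hu.le]
  have e3 : (fun ω => triRV S T x y z ω ^ (1 / 2 : ℝ) * triRV S T x' y' z' ω ^ (1 - 1 / 2 : ℝ))
      = triRV S T (√(x * x')) (√(y * y')) (√(z * z')) := by
    funext ω
    unfold triRV
    split_ifs
    · exact hs _ _ hx hx'
    · exact hs _ _ hy hy'
    · exact hs _ _ hz hz'
  rw [e3] at H
  have px : 0 < √(x * x') := by positivity
  have py : 0 < √(y * y') := by positivity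
  have pz : 0 < √(z * z') := by positivity
  obtain ⟨k, hk, hk1, hk2⟩ := tri_premium_exists h hf hmono hc h1 px py pz
  rw [hk1] at H
  simp only [Real.one_rpow, mul_one] at H
  have hle : ∀ u, 0 < u → f u ≤ f (u / k) := by
    intro u hu
    refine hmono.monotoneOn (show u ∈ Set.Ici 0 from hu.le)
      (show u / k ∈ Set.Ici 0 from by rw [Set.mem_Ici]; positivity) ?_
    rw [le_div_iff₀ hk]; nlinarith
  rw [← hk2]
  have := hle _ px
  have := hle _ py
  have := hle _ pz
  gcongr

lemma tri_CA (h : TriPart P S T p q r)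
    (hf : ∀ x, 0 ≤ x → Φ x = f x) (hmono : StrictMonoOn f (Set.Ici 0))
    (hc : ContinuousOn f (Set.Ici 0)) (h1 : f 1 = 1)
    (hca : ∀ X : Ω → ℝ, MemLinftyPlus P X → ∀ h : ℝ, 0 ≤ h →
      orliczPremium P Φ (fun ω => X ω + h) = orliczPremium P Φ X + h)
    (x y z t : ℝ) (hx : 0 ≤ x) (hy : 0 ≤ y) (hz : 0 ≤ z) (ht : 0 < t)
    (e : p * f x + q * f y + r * f z = 1) :
    p * f ((x + t) / (1 + t)) + q * f ((y + t) / (1 + t)) + r * f ((z + t) / (1 + t)) = 1 := by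
  have H := hca _ (triRV_mem P h.hS h.hT hx hy hz) t ht.le
  rw [tri_premium_eq h hf hmono h1 hx hy hz one_pos (by simpa using e)] at H
  have e3 : (fun ω => triRV S T x y z ω + t) = triRV S T (x + t) (y + t) (z + t) := by
    funext ω
    unfold triRV
    split_ifs <;> rfl
  rw [e3] at H
  obtain ⟨k, hk, hk1, hk2⟩ := tri_premium_exists h hf hmono hc h1
    (show 0 < x + t by positivity) (show 0 < y + t by positivity) (show 0 < z + t by positivity)
  rw [H] at hk1
  rw [hk1]
  exact hk2

end

lemma triPart_two {P : Measure Ω} [IsProbabilityMeasure P] {A : Set Ω} (hA : MeasurableSet A)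
    {p : ℝ} (hp : 0 ≤ p) (hp1 : p ≤ 1) (hPA : P A = ENNReal.ofReal p) :
    TriPart P A ∅ p 0 (1 - p) := by
  refine ⟨hA, MeasurableSet.empty, by simp, hp, le_rfl, by linarith, by ring, hPA, by simp, ?_⟩
  rw [Set.union_empty, prob_compl_eq_one_sub hA, hPA, ENNReal.ofReal_sub _ hp, ENNReal.ofReal_one]

lemma triPart_three {P : Measure Ω} [IsProbabilityMeasure P]
    (hP : ∀ p : ℝ, 0 ≤ p → p ≤ 1 →
      ∃ A : Set Ω, MeasurableSet A ∧ P A = ENNReal.ofReal p) :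
    ∃ S T : Set Ω, ∃ p q r : ℝ, 0 < p ∧ 0 < q ∧ 0 < r ∧ TriPart P S T p q r := by
  obtain ⟨A, hA, hPA⟩ := hP (1 / 2) (by norm_num) (by norm_num)
  obtain ⟨D, hD, hPD⟩ := hP (1 / 4) (by norm_num) (by norm_num)
  have rA : P.real A = 1 / 2 := by
    rw [measureReal_def, hPA, ENNReal.toReal_ofReal (by norm_num)]
  have rD : P.real D = 1 / 4 := by
    rw [measureReal_def, hPD, ENNReal.toReal_ofReal (by norm_num)]
  have rAc : P.real Aᶜ = 1 / 2 := by
    rw [probReal_compl_eq_one_sub hA, rA]; norm_num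
  have i1 : P.real A - P.real D ≤ P.real (A \ D) := le_measureReal_sdiff
  have i2 : P.real Aᶜ - P.real D ≤ P.real (Aᶜ \ D) := le_measureReal_sdiff
  have hdis : Disjoint D (A \ D) := Set.disjoint_sdiff_right
  have hset : (D ∪ A \ D)ᶜ = Aᶜ \ D := by
    ext ω; simp only [Set.mem_compl_iff, Set.mem_union, Set.mem_sdiff]; tauto
  have hs : P.real D + P.real (A \ D) + P.real (Aᶜ \ D) = 1 := by
    rw [← hset, probReal_compl_eq_one_sub (hD.union (hA.diff hD)),
      measureReal_union hdis (hA.diff hD)]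
    ring
  refine ⟨D, A \ D, P.real D, P.real (A \ D), P.real (Aᶜ \ D), by linarith, by linarith,
    by linarith, hD, hA.diff hD, hdis, by linarith, by linarith, by linarith, hs, ?_, ?_, ?_⟩
  · exact (ofReal_measureReal).symm
  · exact (ofReal_measureReal).symm
  · rw [hset]; exact (ofReal_measureReal).symm

/-- on a nonatomic probability space, with `Φ` finite, continuous and
strictly increasing: if `H_Φ` is cash-additive and GG-convex, then
`Φ(x) = 1 + a(x-1)₊ - b(x-1)₋` with `a ≥ b > 0`. -/
theorem orliczPremium_cashAdditive_ggConvex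
    (P : Measure Ω) [IsProbabilityMeasure P]
    (hP : ∀ p : ℝ, 0 ≤ p → p ≤ 1 →
      ∃ A : Set Ω, MeasurableSet A ∧ P A = ENNReal.ofReal p)
    (Φ : ℝ → EReal) (hΦ : IsOrliczFunction Φ)
    (hfin : ∀ x : ℝ, 0 ≤ x → Φ x ≠ ⊥ ∧ Φ x ≠ ⊤)
    (hcont : ContinuousOn Φ (Set.Ici (0 : ℝ)))
    (hstrict : StrictMonoOn Φ (Set.Ici (0 : ℝ)))
    (hca : ∀ X : Ω → ℝ, MemLinftyPlus P X → ∀ h : ℝ, 0 ≤ h →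
      orliczPremium P Φ (fun ω => X ω + h) = orliczPremium P Φ X + h)
    (hGG : ∀ X Y : Ω → ℝ, MemLinftyPlus P X → MemLinftyPlus P Y →
      ∀ l ∈ Set.Ioo (0 : ℝ) 1,
        orliczPremium P Φ (fun ω => X ω ^ l * Y ω ^ (1 - l)) ≤
          orliczPremium P Φ X ^ l * orliczPremium P Φ Y ^ (1 - l)) :
    ∃ a b : ℝ, 0 < b ∧ b ≤ a ∧
      ∀ x : ℝ, 0 ≤ x →
        Φ x = ((1 + a * max (x - 1) 0 - b * max (1 - x) 0 : ℝ) : EReal) := by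
  set f : ℝ → ℝ := fun x => (Φ x).toReal with hfdef
  have hf : ∀ x, 0 ≤ x → Φ x = f x := fun x hx =>
    (EReal.coe_toReal (hfin x hx).2 (hfin x hx).1).symm
  have hmono : StrictMonoOn f (Set.Ici 0) := by
    intro x hx y hy hxy
    have := hstrict hx hy hxy
    rw [hf x hx, hf y hy] at this
    exact_mod_cast this
  have hc : ContinuousOn f (Set.Ici 0) := by
    refine EReal.continuousOn_toReal.comp hcont ?_
    intro x hx
    have := hfin x hx
    simp [this.1, this.2]
  have h1 : f 1 = 1 := by
    apply le_antisymm
    · have := hΦ.le_one 1 zero_le_one le_rfl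
      rw [hf 1 zero_le_one] at this
      exact_mod_cast this
    · have ht : Tendsto f (nhdsWithin 1 (Set.Ioi 1)) (nhds (f 1)) :=
        ((hc 1 (by simp)).mono (fun x hx => by
          rw [Set.mem_Ici]; exact zero_le_one.trans (le_of_lt hx))).tendsto
      refine ge_of_tendsto ht ?_
      filter_upwards [self_mem_nhdsWithin] with x hx
      have hx' : (1:ℝ) < x := hx
      have := hΦ.one_lt x hx'
      rw [hf x (by linarith)] at this
      have h2 : (1:ℝ) < f x := by exact_mod_cast this
      exact h2.le
  obtain ⟨A, B, c, hA, hB, hc0, hfp, hfm⟩ := aux_power f hmono hc h1 (by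
    intro p u v h hp hp1 hu hv hv1 hh e
    obtain ⟨S, hS, hPS⟩ := hP p hp hp1
    have := tri_CA (triPart_two hS hp hp1 hPS) hf hmono hc h1 hca u 1 v h (by linarith)
      zero_le_one hv hh (by linarith)
    linarith)
  obtain ⟨S, T, p, q, r, hp, hq, hr, hpart⟩ := triPart_three hP
  have hc1 : c = 1 := aux_exponent f A B c p q r hA hB hc0 h1 hfp hfm hp hq hr hpart.hsum
    (tri_GG hpart hf hmono hc h1 hGG)
  subst hc1
  simp only [Real.rpow_one] at hfp hfm
  have hBA : B ≤ A := aux_slopes f A B hA hB hmono h1 hfp hfm (by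
    intro x z x' z' hx hz hx' hz' e e'
    obtain ⟨S, hS, hPS⟩ := hP (1 / 2) (by norm_num) (by norm_num)
    have := tri_GG (triPart_two hS (by norm_num) (by norm_num) hPS) hf hmono hc h1 hGG
      x 1 z x' 1 z' hx one_pos hz hx' one_pos hz' (by linarith) (by linarith)
    linarith)
  refine ⟨A, B, hB, hBA, ?_⟩
  intro x hx
  rw [hf x hx]
  congr 1
  rcases lt_trichotomy x 1 with h | rfl | h
  · have := hfm (1 - x) (by linarith) (by linarith)
    rw [max_eq_right (by linarith), max_eq_left (by linarith)]
    rw [show 1 - (1 - x) = x by ring] at this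
    linarith
  · simp [h1]
  · have := hfp (x - 1) (by linarith)
    rw [max_eq_left (by linarith), max_eq_right (by linarith)]
    rw [show 1 + (x - 1) = x by ring] at this
    linarith
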